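/- arXiv:1210.0880 — 2 statements merged into one kernel-verified Lean document; each statement's English description precedes it below -/
import Mathlib

section
/- The solution of the diffusion equation is unique: if u : ℝ → H satisfies u(0) = u₀, and for every index j and every s ∈ ℝ the real-valued function s ↦ ⟨u(s), φ_j⟩ is differentiable at s with derivative −λ_j ⟨u(s), φ_j⟩, then u(t) = P_t u₀ for every t ≥ 0. -/
open scoped RealInnerProductSpace

/-- The Schrödinger diffusion semigroup `P_t u = Σ_j e^{-λ_j t} ⟨u, φ_j⟩ φ_j`. -/
noncomputable def schrodingerSemigroup {H : Type*} [NormedAddCommGroup H]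
    [InnerProductSpace ℝ H] [CompleteSpace H]
    (φ : HilbertBasis ℕ ℝ H) (lam : ℕ → ℝ) (t : ℝ) (u : H) : H :=
  ∑' j : ℕ, (Real.exp (-lam j * t) * ⟪u, φ j⟫) • (φ j : H)

/-- A solution of the scalar linear equation with rate `c` is an exponential. -/
theorem eq_exp_mul_of_hasDerivAt_mul {f : ℝ → ℝ} {c : ℝ}
    (hf : ∀ s, HasDerivAt f (c * f s) s) (t : ℝ) : f t = Real.exp (c * t) * f 0 := by
  have hderiv (s : ℝ) : HasDerivAt (fun r => Real.exp (-(c * r)) * f r) 0 s := by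
    have hexp : HasDerivAt (fun r => Real.exp (-(c * r))) (Real.exp (-(c * s)) * -(c * 1)) s :=
      ((hasDerivAt_id s).const_mul c).neg.exp
    exact (hexp.mul (hf s)).congr_deriv (by ring)
  have hconst := is_const_of_deriv_eq_zero (fun s => (hderiv s).differentiableAt)
    (fun s => (hderiv s).deriv) t 0
  simp only [mul_zero, neg_zero, Real.exp_zero, one_mul] at hconst
  rw [← hconst, ← mul_assoc, ← Real.exp_add, add_neg_cancel, Real.exp_zero, one_mul]

/-- uniqueness of solutions of the diffusion equation: if `u : ℝ → H`
satisfies `u 0 = u₀` and, for every `j` and every `s ∈ ℝ`, the function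
`s ↦ ⟨u s, φ_j⟩` is differentiable at `s` with derivative `-λ_j ⟨u s, φ_j⟩`,
then `u t = P_t u₀` for every `t ≥ 0`. -/
theorem schrodinger_diffusion_unique
    {H : Type*} [NormedAddCommGroup H] [InnerProductSpace ℝ H] [CompleteSpace H]
    (φ : HilbertBasis ℕ ℝ H) (lam : ℕ → ℝ) (hlam : ∀ j, 0 ≤ lam j)
    (u₀ : H) (u : ℝ → H) (h0 : u 0 = u₀)
    (hode : ∀ (j : ℕ) (s : ℝ),
      HasDerivAt (fun r : ℝ => ⟪u r, φ j⟫) (-lam j * ⟪u s, φ j⟫) s) :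
    ∀ t : ℝ, 0 ≤ t → u t = schrodingerSemigroup φ lam t u₀ := by
  intro t _
  rw [schrodingerSemigroup, ← (φ.hasSum_repr (u t)).tsum_eq]
  refine tsum_congr fun j => ?_
  rw [φ.repr_apply_apply, real_inner_comm, eq_exp_mul_of_hasDerivAt_mul (hode j) t, h0]
end

section
/- Let ξ > ‖V‖, f ∈ H, and let ε ≥ 0 satisfy ε ‖N‖ < ξ − ‖V‖. If u solves A u + V u + ξ u = f and u_ε solves A u_ε + V u_ε + ε N u_ε + ξ u_ε = f, then ‖u_ε − u‖ ≤ ε ‖N‖ ‖f‖ / ((ξ − ‖V‖ − ε ‖N‖)(ξ − ‖V‖)). In particular, u_ε converges in norm to u as ε → 0, i.e., the resolvents of the perturbed operators converge strongly. -/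
open scoped RealInnerProductSpace

/-- A positive semidefinite operator plus a bounded perturbation plus a shift is bounded below. -/
theorem sub_opNorm_mul_norm_le_norm_add_add_smul
    {H : Type*} [NormedAddCommGroup H] [InnerProductSpace ℝ H]
    (A W : H →L[ℝ] H) (hApos : ∀ u : H, 0 ≤ ⟪A u, u⟫) (ξ : ℝ) (w : H) :
    (ξ - ‖W‖) * ‖w‖ ≤ ‖A w + W w + ξ • w‖ := by
  rcases (norm_nonneg w).eq_or_lt with hw | hw
  · rw [← hw, mul_zero]
    exact norm_nonneg _
  · refine le_of_mul_le_mul_right ?_ hw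
    have hinner : ⟪A w + W w + ξ • w, w⟫ = ⟪A w, w⟫ + ⟪W w, w⟫ + ξ * (‖w‖ * ‖w‖) := by
      rw [inner_add_left, inner_add_left, real_inner_smul_left, real_inner_self_eq_norm_mul_norm]
    have hW : -(‖W‖ * ‖w‖ * ‖w‖) ≤ ⟪W w, w⟫ := by
      refine neg_le_of_abs_le ((abs_real_inner_le_norm _ _).trans ?_)
      gcongr
      exact W.le_opNorm w
    linarith [hApos w, real_inner_le_norm (A w + W w + ξ • w) w]

/-- strong resolvent convergence under bounded perturbations of the
potential: with `A, V, N` continuous self-adjoint operators on a real Hilbert space,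
`A` positive semidefinite, `ξ > ‖V‖`, `ε ≥ 0` with `ε ‖N‖ < ξ − ‖V‖`, if
`A u + V u + ξ u = f` and `A u_ε + V u_ε + ε N u_ε + ξ u_ε = f`, then
`‖u_ε − u‖ ≤ ε ‖N‖ ‖f‖ / ((ξ − ‖V‖ − ε ‖N‖)(ξ − ‖V‖))`. -/
theorem schrodinger_resolvent_perturbation_estimate
    {H : Type*} [NormedAddCommGroup H] [InnerProductSpace ℝ H] [CompleteSpace H]
    (A V N : H →L[ℝ] H) (hA : IsSelfAdjoint A) (hV : IsSelfAdjoint V)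
    (hN : IsSelfAdjoint N) (hApos : ∀ u : H, 0 ≤ ⟪A u, u⟫)
    (ξ : ℝ) (hξ : ‖V‖ < ξ) (f : H)
    (ε : ℝ) (hε : 0 ≤ ε) (hεN : ε * ‖N‖ < ξ - ‖V‖)
    (u uε : H)
    (hu : A u + V u + ξ • u = f)
    (huε : A uε + V uε + ε • (N uε) + ξ • uε = f) :
    ‖uε - u‖ ≤ ε * ‖N‖ * ‖f‖ / ((ξ - ‖V‖ - ε * ‖N‖) * (ξ - ‖V‖)) := by
  have hV0 : 0 < ξ - ‖V‖ := sub_pos.2 hξ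
  have hVN0 : 0 < ξ - ‖V‖ - ε * ‖N‖ := sub_pos.2 hεN
  have hu_norm : (ξ - ‖V‖) * ‖u‖ ≤ ‖f‖ := by
    simpa only [hu] using sub_opNorm_mul_norm_le_norm_add_add_smul A V hApos ξ u
  have hW : ‖V + ε • N‖ ≤ ‖V‖ + ε * ‖N‖ := by
    refine (norm_add_le _ _).trans_eq ?_
    rw [norm_smul, Real.norm_of_nonneg hε]
  have hres : A (uε - u) + (V + ε • N) (uε - u) + ξ • (uε - u) = -(ε • N u) := by
    have h := huε.trans hu.symm
    simp only [map_sub, add_apply, smul_apply, smul_sub]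
    rw [← sub_eq_zero] at h ⊢
    rw [← h]
    abel
  have hres_norm : ‖-(ε • N u)‖ ≤ ε * (‖N‖ * ‖u‖) := by
    rw [norm_neg, norm_smul, Real.norm_of_nonneg hε]
    gcongr
    exact N.le_opNorm u
  have hdiff : (ξ - ‖V‖ - ε * ‖N‖) * ‖uε - u‖ ≤ ε * (‖N‖ * ‖u‖) := by
    have h := sub_opNorm_mul_norm_le_norm_add_add_smul A (V + ε • N) hApos ξ (uε - u)
    rw [hres] at h
    refine le_trans ?_ (h.trans hres_norm)
    exact mul_le_mul_of_nonneg_right (by linarith) (norm_nonneg _)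
  rw [le_div_iff₀ (mul_pos hVN0 hV0)]
  calc ‖uε - u‖ * ((ξ - ‖V‖ - ε * ‖N‖) * (ξ - ‖V‖))
      = (ξ - ‖V‖ - ε * ‖N‖) * ‖uε - u‖ * (ξ - ‖V‖) := by ring
    _ ≤ ε * (‖N‖ * ‖u‖) * (ξ - ‖V‖) := by gcongr
    _ = ε * ‖N‖ * ((ξ - ‖V‖) * ‖u‖) := by ring
    _ ≤ ε * ‖N‖ * ‖f‖ := by gcongr
end
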